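/- arXiv:2008.00758 — 2 statements merged into one kernel-verified Lean document; each statement's English description precedes it below -/
import Mathlib

section
/- For every bounded linear operator S on a complex Hilbert space, dw(S) ≤ √‖(1/4)(|S| + |S*|)² + |S|⁴‖. -/
open scoped InnerProductSpace

variable {H : Type*} [NormedAddCommGroup H] [InnerProductSpace ℂ H] [CompleteSpace H]

noncomputable def numRadius (S : H →L[ℂ] H) : ℝ :=
  ⨆ x : {x : H // ‖x‖ = 1}, ‖(⟪S x.1, x.1⟫_ℂ : ℂ)‖

noncomputable def dwRadius (S : H →L[ℂ] H) : ℝ :=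
  ⨆ x : {x : H // ‖x‖ = 1}, Real.sqrt (‖(⟪S x.1, x.1⟫_ℂ : ℂ)‖ ^ 2 + ‖S x.1‖ ^ 4)

/-- The absolute value `|S| = (S*S)^{1/2}` of an operator. -/
noncomputable def opAbs (S : H →L[ℂ] H) : H →L[ℂ] H :=
  CFC.sqrt (ContinuousLinearMap.adjoint S * S)

section CStarAlgebra

variable {A : Type*} [CStarAlgebra A] [PartialOrder A] [StarOrderedRing A]

/-- If `p, q ≥ 0` and `x p + q x = 0`, then `x p = 0`. -/
lemma mul_eq_zero_of_add_mul_eq_zero {p q x : A} (hp : 0 ≤ p) (hq : 0 ≤ q)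
    (h : x * p + q * x = 0) : x * p = 0 := by
  have hxp : x * p = -(q * x) := eq_neg_of_add_eq_zero_left h
  have hneg : star x * x * p = -(star x * q * x) := by
    rw [mul_assoc, hxp, mul_neg, mul_assoc]
  have hconj : 0 ≤ star x * q * x := star_left_conjugate_nonneg hq x
  have hsa : IsSelfAdjoint (star x * x * p) := by
    rw [hneg]
    exact (IsSelfAdjoint.of_nonneg hconj).neg
  have hcomm : Commute (star x * x) p :=
    ((IsSelfAdjoint.star_mul_self x).commute_iff (IsSelfAdjoint.of_nonneg hp)).2 hsa
  have hzero : star x * x * p = 0 :=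
    le_antisymm (hneg ▸ neg_nonpos.2 hconj) (hcomm.mul_nonneg (star_mul_self_nonneg x) hp)
  rw [← CStarRing.star_mul_self_eq_zero_iff, star_mul, mul_assoc, ← mul_assoc (star x), hzero,
    mul_zero]

/-- An element intertwining the squares of two nonnegative elements intertwines the elements. -/
lemma SemiconjBy.of_mul_self_of_nonneg {p q s : A} (hp : 0 ≤ p) (hq : 0 ≤ q)
    (h : SemiconjBy s (p * p) (q * q)) : SemiconjBy s p q := by
  set x := s * p - q * s with hx
  have hsum : x * p + q * x = 0 := by
    have h' : s * (p * p) = q * q * s := h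
    calc x * p + q * x = s * (p * p) - q * q * s := by rw [hx]; noncomm_ring
      _ = 0 := sub_eq_zero.2 h'
  have hxp : x * p = 0 := mul_eq_zero_of_add_mul_eq_zero hp hq hsum
  have hqx : q * x = 0 := by simpa [hxp] using hsum
  have hpx : p * star x = 0 := by
    simpa [(IsSelfAdjoint.of_nonneg hp).star_eq] using congrArg star hxp
  have hxq : star x * q = 0 := by
    simpa [(IsSelfAdjoint.of_nonneg hq).star_eq] using congrArg star hqx
  have hcube : star x * (x * star x) = 0 := by
    calc star x * (x * star x)
        = star x * s * (p * star x) - star x * q * (s * star x) := by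
          nth_rewrite 2 [hx]; noncomm_ring
      _ = 0 := by rw [hpx, hxq, mul_zero, zero_mul, sub_zero]
  have hsq : x * star x = 0 := by
    rw [← CStarRing.star_mul_self_eq_zero_iff, star_mul, star_star, mul_assoc, hcube, mul_zero]
  exact sub_eq_zero.1 ((CStarRing.mul_star_self_eq_zero_iff x).1 hsq)

end CStarAlgebra

lemma opAbs_nonneg (S : H →L[ℂ] H) : 0 ≤ opAbs S := CFC.sqrt_nonneg _

lemma opAbs_mul_self (S : H →L[ℂ] H) :
    opAbs S * opAbs S = ContinuousLinearMap.adjoint S * S :=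
  CFC.sqrt_mul_sqrt_self _ (star_mul_self_nonneg S)

lemma semiconjBy_opAbs (S : H →L[ℂ] H) :
    SemiconjBy S (opAbs S) (opAbs (ContinuousLinearMap.adjoint S)) := by
  refine .of_mul_self_of_nonneg (opAbs_nonneg _) (opAbs_nonneg _) ?_
  rw [opAbs_mul_self, opAbs_mul_self, ContinuousLinearMap.adjoint_adjoint]
  exact (mul_assoc _ _ _).symm

lemma re_inner_nonneg_of_nonneg {E : Type*} [NormedAddCommGroup E] [InnerProductSpace ℂ E]
    {T : E →L[ℂ] E} (hT : 0 ≤ T) (x : E) :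
    0 ≤ (⟪T x, x⟫_ℂ).re :=
  ((ContinuousLinearMap.nonneg_iff_isPositive T).1 hT).re_inner_nonneg_left x

lemma inner_apply_left_of_nonneg {E : Type*} [NormedAddCommGroup E] [InnerProductSpace ℂ E]
    {T : E →L[ℂ] E} (hT : 0 ≤ T) (x y : E) :
    ⟪T x, y⟫_ℂ = ⟪x, T y⟫_ℂ :=
  ((ContinuousLinearMap.nonneg_iff_isPositive T).1 hT).inner_left_eq_inner_right x y

lemma inner_apply_apply_eq_opAbs (S : H →L[ℂ] H) (x y : H) :
    ⟪S x, S y⟫_ℂ = ⟪opAbs S x, opAbs S y⟫_ℂ := by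
  rw [inner_apply_left_of_nonneg (opAbs_nonneg S), ← ContinuousLinearMap.adjoint_inner_right]
  exact congrArg (fun T : H →L[ℂ] H => ⟪x, T y⟫_ℂ) (opAbs_mul_self S).symm

/-- The mixed Schwarz inequality in additive form. -/
lemma two_mul_re_inner_le_opAbs (S : H →L[ℂ] H) (x y : H) :
    2 * (⟪S x, y⟫_ℂ).re ≤
      (⟪opAbs S x, x⟫_ℂ).re + (⟪opAbs (ContinuousLinearMap.adjoint S) y, y⟫_ℂ).re := by
  set P := opAbs S with hP
  set Q := opAbs (ContinuousLinearMap.adjoint S) with hQ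
  have hP0 : 0 ≤ P := opAbs_nonneg _
  have hQ0 : 0 ≤ Q := opAbs_nonneg _
  suffices h : ∀ ε : ℝ, 0 < ε → 2 * (⟪S x, y⟫_ℂ).re ≤
      (⟪P x, x⟫_ℂ).re + (⟪Q y, y⟫_ℂ).re + ε * ‖y‖ ^ 2 by
    refine ge_of_tendsto (x := nhdsWithin (0 : ℝ) (Set.Ioi 0)) (f := fun ε : ℝ =>
      (⟪P x, x⟫_ℂ).re + (⟪Q y, y⟫_ℂ).re + ε * ‖y‖ ^ 2) ?_
      (Filter.eventually_of_mem self_mem_nhdsWithin h)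
    refine Filter.Tendsto.mono_left ?_ nhdsWithin_le_nhds
    exact Continuous.tendsto' (by fun_prop) _ _ (by simp)
  intro ε hε
  obtain ⟨z, hz⟩ : ∃ z, P z + (ε : ℂ) • z = x := by
    have hunit : IsUnit (P + algebraMap ℝ (H →L[ℂ] H) ε) := by
      refine (IsStrictlyPositive.nonneg_add hP0 ?_).isUnit
      exact IsStrictlyPositive.iff_of_unital.2
        ⟨algebraMap_nonneg _ hε.le, (IsUnit.mk0 ε hε.ne').map (algebraMap ℝ (H →L[ℂ] H))⟩
    obtain ⟨R, hR⟩ := hunit.exists_right_inv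
    refine ⟨R x, ?_⟩
    simpa [Algebra.algebraMap_eq_smul_one] using congrArg (fun T : H →L[ℂ] H => T x) hR
  have hSx : S x = Q (S z) + (ε : ℂ) • S z := by
    have hcomm : S (P z) = Q (S z) :=
      congrArg (fun T : H →L[ℂ] H => T z) (semiconjBy_opAbs S)
    rw [← hz, map_add, map_smul, hcomm]
  have hxz : (⟪S x, S z⟫_ℂ).re ≤ (⟪P x, x⟫_ℂ).re := by
    have hdiff : ⟪P x, x⟫_ℂ = ⟪S x, S z⟫_ℂ +
        ((ε : ℂ) * ⟪P z, P z⟫_ℂ + (ε : ℂ) * ((ε : ℂ) * ⟪P z, z⟫_ℂ)) := by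
      have h1 : ⟪P x, x⟫_ℂ = ⟪P x, P z⟫_ℂ + (ε : ℂ) * ⟪P x, z⟫_ℂ := by
        nth_rewrite 2 [← hz]
        rw [inner_add_right, inner_smul_right]
      have h2 : ⟪P x, z⟫_ℂ = ⟪P z, P z⟫_ℂ + (ε : ℂ) * ⟪P z, z⟫_ℂ := by
        rw [inner_apply_left_of_nonneg hP0, ← hz, inner_add_left, inner_smul_left,
          Complex.conj_ofReal, inner_apply_left_of_nonneg hP0 z z]
      rw [h1, h2, inner_apply_apply_eq_opAbs S]
      ring
    have hPz : 0 ≤ (⟪P z, P z⟫_ℂ).re := inner_self_nonneg (𝕜 := ℂ)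
    have hzz := re_inner_nonneg_of_nonneg hP0 z
    rw [hdiff]
    simp only [Complex.add_re, Complex.re_ofReal_mul]
    have : 0 ≤ ε * (⟪P z, P z⟫_ℂ).re + ε * (ε * (⟪P z, z⟫_ℂ).re) := by positivity
    linarith
  have hsq := re_inner_nonneg_of_nonneg hQ0 (S z - y)
  have hsq' : 0 ≤ ε * (⟪S z - y, S z - y⟫_ℂ).re :=
    mul_nonneg hε.le (inner_self_nonneg (𝕜 := ℂ))
  have hyy : (⟪y, y⟫_ℂ).re = ‖y‖ ^ 2 := inner_self_eq_norm_sq (𝕜 := ℂ) y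
  have hsymm : (⟪Q y, S z⟫_ℂ).re = (⟪Q (S z), y⟫_ℂ).re := by
    rw [inner_apply_left_of_nonneg hQ0]
    exact inner_re_symm (𝕜 := ℂ) _ _
  have hsymm' : (⟪y, S z⟫_ℂ).re = (⟪S z, y⟫_ℂ).re := inner_re_symm (𝕜 := ℂ) _ _
  have hxz' : (⟪S x, S z⟫_ℂ).re = (⟪Q (S z), S z⟫_ℂ).re + ε * (⟪S z, S z⟫_ℂ).re := by
    rw [hSx, inner_add_left, inner_smul_left, Complex.conj_ofReal, Complex.add_re,
      Complex.re_ofReal_mul]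
  have hxy : (⟪S x, y⟫_ℂ).re = (⟪Q (S z), y⟫_ℂ).re + ε * (⟪S z, y⟫_ℂ).re := by
    rw [hSx, inner_add_left, inner_smul_left, Complex.conj_ofReal, Complex.add_re,
      Complex.re_ofReal_mul]
  simp only [map_sub, inner_sub_left, inner_sub_right, Complex.sub_re] at hsq hsq'
  rw [hsymm] at hsq
  rw [hsymm', hyy] at hsq'
  linarith

lemma two_mul_norm_inner_le_opAbs (S : H →L[ℂ] H) (x : H) :
    2 * ‖⟪S x, x⟫_ℂ‖ ≤
      (⟪(opAbs S + opAbs (ContinuousLinearMap.adjoint S)) x, x⟫_ℂ).re := by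
  obtain ⟨c, hc, hcS⟩ := RCLike.exists_norm_eq_mul_self (K := ℂ) ⟪S x, x⟫_ℂ
  have h := two_mul_re_inner_le_opAbs S x (c • x)
  have hre : (c * ⟪S x, x⟫_ℂ).re = ‖⟪S x, x⟫_ℂ‖ :=
    (congrArg Complex.re hcS).symm.trans (Complex.ofReal_re _)
  have hcc : (starRingEnd ℂ) c * c = 1 := by simp [RCLike.conj_mul, hc]
  rw [inner_smul_right, hre, map_smul,
    inner_smul_left, inner_smul_right, ← mul_assoc, hcc, one_mul] at h
  rwa [add_apply, inner_add_left, Complex.add_re]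

lemma sq_re_inner_le_re_inner_sq {E : Type*} [NormedAddCommGroup E] [InnerProductSpace ℂ E]
    {T : E →L[ℂ] E} (hT : 0 ≤ T) {x : E} (hx : ‖x‖ = 1) :
    (⟪T x, x⟫_ℂ).re ^ 2 ≤ (⟪(T ^ 2) x, x⟫_ℂ).re := by
  have hle : (⟪T x, x⟫_ℂ).re ≤ ‖T x‖ := by
    simpa [hx] using re_inner_le_norm (𝕜 := ℂ) (T x) x
  have hsq : (⟪(T ^ 2) x, x⟫_ℂ).re = ‖T x‖ ^ 2 := by
    rw [pow_two T, mul_apply_eq_comp, inner_apply_left_of_nonneg hT]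
    exact inner_self_eq_norm_sq (𝕜 := ℂ) (T x)
  rw [hsq]
  exact pow_le_pow_left₀ (re_inner_nonneg_of_nonneg hT x) hle 2

theorem dw_upper_bound (S : H →L[ℂ] H) :
    dwRadius S ≤ Real.sqrt
      ‖(1 / 4 : ℝ) • (opAbs S + opAbs (ContinuousLinearMap.adjoint S)) ^ 2 + opAbs S ^ 4‖ := by
  refine Real.iSup_le (fun ⟨x, hx⟩ => Real.sqrt_le_sqrt ?_) (Real.sqrt_nonneg _)
  dsimp only
  set B := opAbs S + opAbs (ContinuousLinearMap.adjoint S) with hB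
  have hB0 : 0 ≤ B := add_nonneg (opAbs_nonneg _) (opAbs_nonneg _)
  have hA0 : 0 ≤ opAbs S ^ 2 := by
    rw [pow_two, opAbs_mul_self]
    exact star_mul_self_nonneg S
  have hinner : 4 * ‖⟪S x, x⟫_ℂ‖ ^ 2 ≤ (⟪(B ^ 2) x, x⟫_ℂ).re := by
    have h := pow_le_pow_left₀ (by positivity) (two_mul_norm_inner_le_opAbs S x) 2
    rw [mul_pow] at h
    linarith [sq_re_inner_le_re_inner_sq hB0 hx]
  have hnorm : ‖S x‖ ^ 4 ≤ (⟪(opAbs S ^ 4) x, x⟫_ℂ).re := by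
    have hSx : (⟪(opAbs S ^ 2) x, x⟫_ℂ).re = ‖S x‖ ^ 2 := by
      rw [pow_two, mul_apply_eq_comp, inner_apply_left_of_nonneg (opAbs_nonneg S),
        ← inner_apply_apply_eq_opAbs]
      exact inner_self_eq_norm_sq (𝕜 := ℂ) (S x)
    have h := sq_re_inner_le_re_inner_sq hA0 hx
    rwa [hSx, ← pow_mul, ← pow_mul] at h
  set T := (1 / 4 : ℝ) • B ^ 2 + opAbs S ^ 4 with hT
  have hTx : (⟪T x, x⟫_ℂ).re =
      1 / 4 * (⟪(B ^ 2) x, x⟫_ℂ).re + (⟪(opAbs S ^ 4) x, x⟫_ℂ).re := by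
    rw [hT, add_apply, smul_apply, inner_add_left,
      Complex.add_re, inner_smul_left_eq_smul, Complex.smul_re, smul_eq_mul]
  have hTle : (⟪T x, x⟫_ℂ).re ≤ ‖T‖ := by
    have h1 : (⟪T x, x⟫_ℂ).re ≤ ‖T x‖ := by
      simpa [hx] using re_inner_le_norm (𝕜 := ℂ) (T x) x
    exact h1.trans (T.unit_le_opNorm x hx.le)
  linarith
end

section
/- For every bounded linear operator S on a complex Hilbert space, √‖(1/4)(|S| + |S*|)² + |S|⁴‖ ≤ √((1/4)(‖S‖ + ‖S²‖^{1/2})² + ‖S‖⁴). -/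
open scoped InnerProductSpace

variable {H : Type*} [NormedAddCommGroup H] [InnerProductSpace ℂ H] [CompleteSpace H]

open scoped ENNReal NNReal

/-- The spectral radius satisfies `r(ab) = r(ba)`. -/
theorem spectralRadius_mul_comm {A : Type*} [NormedRing A] [NormedAlgebra ℂ A] (a b : A) :
    spectralRadius ℂ (a * b) = spectralRadius ℂ (b * a) := by
  have key : ∀ a b : A, spectralRadius ℂ (a * b) ≤ spectralRadius ℂ (b * a) := by
    intro a b
    refine iSup₂_le fun k hk => ?_
    rcases eq_or_ne k 0 with rfl | hk0
    · simp
    · have : k ∈ spectrum ℂ (a * b) \ {0} := ⟨hk, hk0⟩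
      rw [spectrum.nonzero_mul_comm] at this
      exact le_iSup₂ (f := fun k (_ : k ∈ spectrum ℂ (b * a)) => (‖k‖₊ : ℝ≥0∞)) k this.1
  exact le_antisymm (key a b) (key b a)

/-- For positive `a`, `b` in a C⋆-algebra, `‖a^{1/2} b^{1/2}‖² ≤ ‖ab‖`. -/
theorem norm_sqrt_mul_sqrt_sq_le {A : Type*} [CStarAlgebra A] [PartialOrder A] [StarOrderedRing A]
    {a b : A} (ha : 0 ≤ a) (hb : 0 ≤ b) : ‖CFC.sqrt a * CFC.sqrt b‖ ^ 2 ≤ ‖a * b‖ := by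
  have hsb : IsSelfAdjoint (CFC.sqrt b) := .of_nonneg (CFC.sqrt_nonneg b)
  have h1 : ‖CFC.sqrt a * CFC.sqrt b‖ ^ 2 = ‖CFC.sqrt b * (a * CFC.sqrt b)‖ := by
    rw [← mul_assoc, CFC.IsSelfAdjoint.norm_mul_mul_self_of_nonneg _ hsb ha]
  have hs : IsSelfAdjoint (CFC.sqrt b * (a * CFC.sqrt b)) := by
    rw [← mul_assoc]
    simpa [hsb.star_eq] using (IsSelfAdjoint.of_nonneg ha).conjugate (CFC.sqrt b)
  have h2 : (‖CFC.sqrt b * (a * CFC.sqrt b)‖₊ : ℝ≥0∞) ≤ ‖a * b‖₊ := by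
    rw [← hs.spectralRadius_eq_nnnorm, spectralRadius_mul_comm, mul_assoc,
      CFC.sqrt_mul_sqrt_self b hb]
    cases subsingleton_or_nontrivial A
    · simp [Subsingleton.elim (a * b) 0, spectralRadius]
    · exact spectrum.spectralRadius_le_nnnorm _
  rw [h1]
  exact_mod_cast h2

theorem norm_abs_mul_abs_star {A : Type*} [CStarAlgebra A] [PartialOrder A] [StarOrderedRing A]
    (a : A) : ‖CFC.abs a * CFC.abs (star a)‖ = ‖a * a‖ := by
  have hs : star (CFC.abs a) = CFC.abs a := (IsSelfAdjoint.of_nonneg (CFC.abs_nonneg a)).star_eq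
  have hs' : star (CFC.abs (star a)) = CFC.abs (star a) :=
    (IsSelfAdjoint.of_nonneg (CFC.abs_nonneg _)).star_eq
  have h1 : ‖CFC.abs a * CFC.abs (star a)‖ = ‖a * CFC.abs (star a)‖ := by
    refine (mul_self_inj (norm_nonneg _) (norm_nonneg _)).1 ?_
    rw [← CStarRing.norm_star_mul_self, ← CStarRing.norm_star_mul_self, star_mul, star_mul,
      hs, mul_assoc, ← mul_assoc (CFC.abs a), CFC.abs_mul_abs]
    simp only [mul_assoc]
  have h2 : ‖a * CFC.abs (star a)‖ = ‖a * a‖ := by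
    refine (mul_self_inj (norm_nonneg _) (norm_nonneg _)).1 ?_
    rw [← CStarRing.norm_self_mul_star, ← CStarRing.norm_self_mul_star, star_mul, star_mul,
      hs', mul_assoc, ← mul_assoc (CFC.abs (star a)), CFC.abs_mul_abs, star_star]
    simp only [mul_assoc]
  rw [h1, h2]

theorem norm_sq_add_sq_le {a b : H →L[ℂ] H} (ha : IsSelfAdjoint a) (hb : IsSelfAdjoint b) {m : ℝ}
    (hma : ‖a‖ ^ 2 ≤ m) (hmb : ‖b‖ ^ 2 ≤ m) : ‖a * a + b * b‖ ≤ m + ‖a * b‖ := by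
  have hm : 0 ≤ m := (sq_nonneg _).trans hma
  refine ContinuousLinearMap.opNorm_le_bound _ (by positivity) fun x => ?_
  have hsa : ∀ y z, ⟪a y, z⟫_ℂ = ⟪y, a z⟫_ℂ := ha.isSymmetric
  have hsb : ∀ y z, ⟪b y, z⟫_ℂ = ⟪y, b z⟫_ℂ := hb.isSymmetric
  have hT : (a * a + b * b) x = a (a x) + b (b x) := rfl
  rw [hT]
  have h1 : ‖a x‖ ^ 2 + ‖b x‖ ^ 2 ≤ ‖x‖ * ‖a (a x) + b (b x)‖ := by
    have h := (Complex.re_le_norm _).trans (norm_inner_le_norm (𝕜 := ℂ) x (a (a x) + b (b x)))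
    rw [inner_add_right, ← hsa, ← hsb, inner_self_eq_norm_sq_to_K, inner_self_eq_norm_sq_to_K] at h
    exact_mod_cast h
  have h2 : ‖a (a x)‖ ^ 2 ≤ m * ‖a x‖ ^ 2 := by
    calc ‖a (a x)‖ ^ 2 ≤ (‖a‖ * ‖a x‖) ^ 2 := by gcongr; exact a.le_opNorm _
      _ ≤ m * ‖a x‖ ^ 2 := by rw [mul_pow]; gcongr
  have h3 : ‖b (b x)‖ ^ 2 ≤ m * ‖b x‖ ^ 2 := by
    calc ‖b (b x)‖ ^ 2 ≤ (‖b‖ * ‖b x‖) ^ 2 := by gcongr; exact b.le_opNorm _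
      _ ≤ m * ‖b x‖ ^ 2 := by rw [mul_pow]; gcongr
  have h4 : RCLike.re ⟪a (a x), b (b x)⟫_ℂ ≤ ‖a * b‖ * (‖a x‖ * ‖b x‖) := by
    rw [hsa]
    calc RCLike.re ⟪a x, a (b (b x))⟫_ℂ ≤ ‖a x‖ * ‖(a * b) (b x)‖ := re_inner_le_norm _ _
      _ ≤ ‖a x‖ * (‖a * b‖ * ‖b x‖) := by gcongr; exact (a * b).le_opNorm _
      _ = _ := by ring
  have h5 := norm_add_sq (𝕜 := ℂ) (a (a x)) (b (b x))
  have h6 : ‖a * b‖ * (2 * ‖a x‖ * ‖b x‖) ≤ ‖a * b‖ * (‖a x‖ ^ 2 + ‖b x‖ ^ 2) := by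
    gcongr; exact two_mul_le_add_sq _ _
  have h7 : ‖a (a x) + b (b x)‖ ^ 2 ≤ (m + ‖a * b‖) * (‖x‖ * ‖a (a x) + b (b x)‖) :=
    calc _ ≤ (m + ‖a * b‖) * (‖a x‖ ^ 2 + ‖b x‖ ^ 2) := by linarith
      _ ≤ _ := by gcongr
  rcases (norm_nonneg (a (a x) + b (b x))).eq_or_lt with h | h
  · rw [← h]; positivity
  · refine le_of_mul_le_mul_right ?_ h
    linarith

/-- For positive operators `a`, `b` of norm at most `m`, `‖a + b‖ ≤ m + ‖ab‖^{1/2}`. -/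
theorem norm_add_le_of_nonneg {a b : H →L[ℂ] H} (ha : 0 ≤ a) (hb : 0 ≤ b) {m : ℝ}
    (hma : ‖a‖ ≤ m) (hmb : ‖b‖ ≤ m) : ‖a + b‖ ≤ m + Real.sqrt ‖a * b‖ := by
  have hsa : IsSelfAdjoint (CFC.sqrt a) := .of_nonneg (CFC.sqrt_nonneg a)
  have hsb : IsSelfAdjoint (CFC.sqrt b) := .of_nonneg (CFC.sqrt_nonneg b)
  have key {c : H →L[ℂ] H} (hc : 0 ≤ c) : ‖CFC.sqrt c‖ ^ 2 = ‖c‖ := by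
    have hsc : IsSelfAdjoint (CFC.sqrt c) := .of_nonneg (CFC.sqrt_nonneg c)
    rw [sq, ← CStarRing.norm_star_mul_self, hsc.star_eq, CFC.sqrt_mul_sqrt_self c hc]
  have h := norm_sq_add_sq_le hsa hsb ((key ha).trans_le hma) ((key hb).trans_le hmb)
  rw [CFC.sqrt_mul_sqrt_self a ha, CFC.sqrt_mul_sqrt_self b hb] at h
  exact h.trans (by gcongr; exact Real.le_sqrt_of_sq_le (norm_sqrt_mul_sqrt_sq_le ha hb))

theorem abs_norm_bound (S : H →L[ℂ] H) :
    Real.sqrt ‖(1 / 4 : ℝ) • (opAbs S + opAbs (ContinuousLinearMap.adjoint S)) ^ 2 + opAbs S ^ 4‖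
      ≤ Real.sqrt ((1 / 4) * (‖S‖ + ‖S * S‖ ^ ((1 : ℝ) / 2)) ^ 2 + ‖S‖ ^ 4) := by
  have hA : opAbs S = CFC.abs S := rfl
  have hB : opAbs (ContinuousLinearMap.adjoint S) = CFC.abs (star S) := rfl
  have hnA : ‖CFC.abs S‖ = ‖S‖ := CFC.norm_abs
  have hnB : ‖CFC.abs (star S)‖ = ‖S‖ := CFC.norm_abs.trans (norm_star S)
  rw [hA, hB, ← Real.sqrt_eq_rpow, ← norm_abs_mul_abs_star]
  have h := norm_add_le_of_nonneg (CFC.abs_nonneg S) (CFC.abs_nonneg (star S)) hnA.le hnB.le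
  refine Real.sqrt_le_sqrt ((norm_add_le _ _).trans (add_le_add ?_ ?_))
  · rw [norm_smul, Real.norm_of_nonneg (by norm_num)]
    gcongr
    exact (norm_pow_le' _ two_pos).trans (by gcongr)
  · exact (norm_pow_le' _ four_pos).trans_eq (by rw [hnA])
end
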